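/- Let Ω ∈ RTSeq_n. A pair of permutations (a, b) satisfies u(Ω) ≤ a ≤ b ≤ v(Ω) in Bruhat order if and only if (a, b) = (u(Ω′), v(Ω′)) for some replacement Ω′ of Ω; that is, the Bruhat intervals contained in [u(Ω), v(Ω)] are exactly the intervals [u(Ω′), v(Ω′)] for Ω′ a replacement of Ω. -/

import Mathlib

/-!
Statement 15.  Let `Ω ∈ RTSeq_n`.  A pair of permutations `(a, b)` satisfies
`u(Ω) ≤ a ≤ b ≤ v(Ω)` in Bruhat order iff `(a, b) = (u(Ω′), v(Ω′))` for some
replacement `Ω′` of `Ω` (a subset of the letters `t_i` replaced by `r_i` or `r_{i+1}`).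
-/

/-- Permutations of the positive integers are modelled by `Equiv.Perm ℕ`, the positive
integer `p` corresponding to `p − 1 : ℕ`.  The insertion map `ins_i` (here `ins (i-1)`,
`0`-indexed) sends `j ↦ w(j) + 1` for `j < i`, `i ↦ 0`, and `j ↦ w(j−1) + 1` for `j > i`. -/
def ins (i : ℕ) (w : Equiv.Perm ℕ) : Equiv.Perm ℕ where
  toFun j := if j < i then w j + 1 else if j = i then 0 else w (j - 1) + 1
  invFun b := if b = 0 then i else if w.symm (b - 1) < i then w.symm (b - 1) else w.symm (b - 1) + 1
  left_inv := by
    intro j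
    dsimp only
    by_cases h1 : j < i
    · rw [if_pos h1, if_neg (by omega : ¬ (w j + 1 = 0)), Nat.add_sub_cancel,
        Equiv.symm_apply_apply, if_pos h1]
    · by_cases h2 : j = i
      · rw [if_neg h1, if_pos h2, if_pos rfl, h2]
      · rw [if_neg h1, if_neg h2, if_neg (by omega : ¬ (w (j - 1) + 1 = 0)),
          Nat.add_sub_cancel, Equiv.symm_apply_apply,
          if_neg (by omega : ¬ (j - 1 < i)), Nat.sub_add_cancel (by omega)]
  right_inv := by
    intro b
    dsimp only
    by_cases hb : b = 0
    · rw [if_pos hb, if_neg (lt_irrefl i), if_pos rfl, hb]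
    · rw [if_neg hb]
      by_cases hc : w.symm (b - 1) < i
      · rw [if_pos hc, if_pos hc, Equiv.apply_symm_apply, Nat.sub_add_cancel (by omega)]
      · rw [if_neg hc, if_neg (by omega : ¬ (w.symm (b - 1) + 1 < i)),
          if_neg (by omega : ¬ (w.symm (b - 1) + 1 = i)), Nat.add_sub_cancel,
          Equiv.apply_symm_apply, Nat.sub_add_cancel (by omega)]

/-- The number `ℓ(u)` of inversions of `u`. -/
noncomputable def invCount (u : Equiv.Perm ℕ) : ℕ :=
  Set.ncard {p : ℕ × ℕ | p.1 < p.2 ∧ u p.2 < u p.1}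

/-- The Bruhat order: `u ≤ v` iff there is a chain `u = w₀, …, w_m = v` where each
`w_{s+1} = w_s · τ_s` for a transposition `τ_s`, with `ℓ(w_{s+1}) > ℓ(w_s)`. -/
noncomputable def bruhatLE (u v : Equiv.Perm ℕ) : Prop :=
  ∃ (m : ℕ) (c : ℕ → Equiv.Perm ℕ), c 0 = u ∧ c m = v ∧
    ∀ s < m, (∃ a b : ℕ, a ≠ b ∧ c (s + 1) = c s * Equiv.swap a b) ∧
      invCount (c s) < invCount (c (s + 1))

/-- `ℓ_a(u) = #{b ≥ a : u⁻¹(b) ≤ u⁻¹(a)}` (0-indexed: this is `ℓ_{a+1}` of the paper). -/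
noncomputable def lA (a : ℕ) (u : Equiv.Perm ℕ) : ℕ :=
  Set.ncard {b : ℕ | a ≤ b ∧ u.symm b ≤ u.symm a}

/-- `u` fixes all but finitely many points, i.e. `u ∈ S_∞`. -/
def finitary (u : Equiv.Perm ℕ) : Prop := {a : ℕ | u a ≠ a}.Finite

/-- `u ∈ S_n`: `u` fixes every point `j > n` (0-indexed: every `j ≥ n`). -/
def inSn (n : ℕ) (u : Equiv.Perm ℕ) : Prop := ∀ j, n ≤ j → u j = j

/-- The formal letters `r_j, t_j` (`j ≥ 1`); here `RTLetter.r k` stands for `r_{k+1}`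
and `RTLetter.t k` for `t_{k+1}`. -/
inductive RTLetter : Type
  | r : ℕ → RTLetter
  | t : ℕ → RTLetter
deriving DecidableEq

/-- One step of the recursion defining `(u(Ω), v(Ω))`:
`r_j` maps `(u,v) ↦ (ins_j u, ins_j v)` and `t_j` maps `(u,v) ↦ (ins_j u, ins_{j+1} v)`. -/
def stepRT (p : Equiv.Perm ℕ × Equiv.Perm ℕ) : RTLetter → Equiv.Perm ℕ × Equiv.Perm ℕ
  | .r k => (ins k p.1, ins k p.2)
  | .t k => (ins k p.1, ins (k + 1) p.2)

/-- The pair `(u(Ω), v(Ω))` attached to a sequence `Ω` (a list of letters, first letter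
first):  `u(∅) = v(∅) = id`, and the last letter is applied outermost. -/
def uv (L : List RTLetter) : Equiv.Perm ℕ × Equiv.Perm ℕ := L.foldl stepRT (1, 1)

/-- The letter at (0-indexed) position `p` of a sequence in `RTSeq_n` must lie in
`{r₁, t₁, …, r_{p}, t_{p}, r_{p+1}}` (1-indexed position `s = p+1`). -/
def validLetter (p : ℕ) : RTLetter → Prop
  | .r k => k ≤ p
  | .t k => k + 1 ≤ p

/-- `Ω ∈ RTSeq_n`: a sequence of `n` letters `X₁⋯X_n` with
`X_s ∈ {r₁, t₁, …, r_{s−1}, t_{s−1}, r_s}`. -/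
def validSeq (n : ℕ) (L : List RTLetter) : Prop :=
  L.length = n ∧ ∀ p < L.length, validLetter p (L.getD p (.r 0))

/-- `|Ω|_t`, the number of letters of the form `t_j`. -/
def countT (L : List RTLetter) : ℕ :=
  L.countP (fun X => match X with | .t _ => true | .r _ => false)

/-- `c_n`, the backwards long cycle `n 1 2 ⋯ (n−1)` (0-indexed on `ℕ`:
`0 ↦ n−1`, `j ↦ j−1` for `1 ≤ j ≤ n−1`, `j ↦ j` for `j ≥ n`). -/
def cB (n : ℕ) : Equiv.Perm ℕ where
  toFun j := if j = 0 then n - 1 else if j ≤ n - 1 then j - 1 else j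
  invFun j := if j = n - 1 then 0 else if j < n - 1 then j + 1 else j
  left_inv := by
    intro j
    dsimp only
    split_ifs <;> (try exact absurd rfl ‹_›) <;> (try exact (‹False›).elim) <;> omega
  right_inv := by
    intro j
    dsimp only
    split_ifs <;> (try exact absurd rfl ‹_›) <;> (try exact (‹False›).elim) <;> omega

/-- `Ω′` is obtained from `Ω` by replacing the letters `t_i` at some subset of the
positions by either `r_i` or `r_{i+1}`. -/
def isReplacement (L L' : List RTLetter) : Prop :=
  L'.length = L.length ∧
  ∀ p < L.length,
    L'.getD p (.r 0) = L.getD p (.r 0) ∨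
    ∃ k, L.getD p (.r 0) = .t k ∧ (L'.getD p (.r 0) = .r k ∨ L'.getD p (.r 0) = .r (k + 1))

open Relation

/-- `w'` is obtained from `w` by transposing the values at a non-inversion `p < q`. -/
def BruhatUp (w w' : Equiv.Perm ℕ) : Prop :=
  ∃ p q, p < q ∧ w p < w q ∧ w' = w * Equiv.swap p q

/-- The increasing enumeration of the naturals different from `i`. -/
def skip (i j : ℕ) : ℕ := if j < i then j else j + 1

theorem skip_strictMono (i : ℕ) : StrictMono (skip i) := by
  intro a b h
  unfold skip
  split_ifs <;> omega

theorem skip_ne (i j : ℕ) : skip i j ≠ i := by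
  unfold skip
  split_ifs <;> omega

theorem exists_skip_eq {i j : ℕ} (h : j ≠ i) : ∃ k, skip i k = j := by
  unfold skip
  rcases lt_or_gt_of_ne h with h | h
  · exact ⟨j, if_pos h⟩
  · exact ⟨j - 1, by split_ifs <;> omega⟩

theorem ins_apply_self (i : ℕ) (w : Equiv.Perm ℕ) : ins i w i = 0 := by
  simp [ins]

theorem ins_apply_skip (i j : ℕ) (w : Equiv.Perm ℕ) : ins i w (skip i j) = w j + 1 := by
  by_cases h : j < i
  · simp [ins, skip, h]
  · have h1 : ¬ j + 1 < i := by omega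
    have h2 : ¬ j + 1 = i := by omega
    simp [ins, skip, h, h1, h2]

theorem ins_symm_zero (i : ℕ) (w : Equiv.Perm ℕ) : (ins i w).symm 0 = i := by
  rw [Equiv.symm_apply_eq, ins_apply_self]

theorem eq_ins_iff {i : ℕ} {x w : Equiv.Perm ℕ} :
    x = ins i w ↔ x i = 0 ∧ ∀ j, x (skip i j) = w j + 1 := by
  constructor
  · rintro rfl
    exact ⟨ins_apply_self i w, fun j => ins_apply_skip i j w⟩
  · rintro ⟨h0, h⟩
    ext j
    by_cases hj : j = i
    · rw [hj, h0, ins_apply_self]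
    · obtain ⟨k, rfl⟩ := exists_skip_eq hj
      rw [h, ins_apply_skip]

theorem ins_inj {i k : ℕ} {w w' : Equiv.Perm ℕ} : ins i w = ins k w' ↔ i = k ∧ w = w' := by
  constructor
  · intro h
    have hik : i = k := by rw [← ins_symm_zero i w, h, ins_symm_zero]
    subst hik
    refine ⟨rfl, Equiv.ext fun j => ?_⟩
    have := (eq_ins_iff.1 h).2 j
    rw [ins_apply_skip] at this
    omega
  · rintro ⟨rfl, rfl⟩
    rfl

theorem exists_eq_ins (x : Equiv.Perm ℕ) : ∃ i w, x = ins i w := by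
  set i := x.symm 0 with hi
  have hpos (j : ℕ) : x (skip i j) ≠ 0 := fun h =>
    skip_ne i j ((Equiv.symm_apply_eq x).2 h.symm).symm
  have hbij : Function.Bijective fun j => x (skip i j) - 1 := by
    constructor
    · intro a b hab
      have ha := hpos a
      have hb := hpos b
      have hab : x (skip i a) - 1 = x (skip i b) - 1 := hab
      exact (skip_strictMono i).injective (x.injective (by omega))
    · intro k
      obtain ⟨j, hj⟩ := exists_skip_eq (i := i) (j := x.symm (k + 1)) (by simp [hi])
      exact ⟨j, by simp [hj]⟩
  refine ⟨i, Equiv.ofBijective _ hbij, eq_ins_iff.2 ⟨by simp [hi], fun j => ?_⟩⟩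
  have := hpos j
  simp only [Equiv.ofBijective_apply]
  omega

theorem ins_mul_swap (i p q : ℕ) (w : Equiv.Perm ℕ) :
    ins i w * Equiv.swap (skip i p) (skip i q) = ins i (w * Equiv.swap p q) := by
  refine eq_ins_iff.2 ⟨?_, fun j => ?_⟩
  · rw [Equiv.Perm.mul_apply,
      Equiv.swap_apply_of_ne_of_ne (skip_ne i p).symm (skip_ne i q).symm, ins_apply_self]
  · rw [Equiv.Perm.mul_apply, ← (skip_strictMono i).injective.map_swap, ins_apply_skip,
      Equiv.Perm.mul_apply]

theorem ins_mul_swap_succ (i : ℕ) (w : Equiv.Perm ℕ) :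
    ins i w * Equiv.swap i (i + 1) = ins (i + 1) w := by
  refine eq_ins_iff.2 ⟨by simp [ins_apply_self], fun j => ?_⟩
  rw [Equiv.Perm.mul_apply, ← ins_apply_skip i j w]
  congr 1
  unfold skip
  rw [Equiv.swap_apply_def]
  split_ifs <;> omega

theorem bruhatUp_ins {w w' : Equiv.Perm ℕ} (i : ℕ) (h : BruhatUp w w') :
    BruhatUp (ins i w) (ins i w') := by
  obtain ⟨p, q, hpq, hw, rfl⟩ := h
  refine ⟨skip i p, skip i q, skip_strictMono i hpq, ?_, (ins_mul_swap i p q w).symm⟩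
  simpa only [ins_apply_skip, add_lt_add_iff_right]

theorem bruhatUp_ins_succ (i : ℕ) (w : Equiv.Perm ℕ) : BruhatUp (ins i w) (ins (i + 1) w) := by
  refine ⟨i, i + 1, by omega, ?_, (ins_mul_swap_succ i w).symm⟩
  have h : skip i i = i + 1 := by simp [skip]
  rw [ins_apply_self, ← h, ins_apply_skip]
  omega

theorem BruhatUp.symm_zero_le {x y : Equiv.Perm ℕ} (h : BruhatUp x y) :
    x.symm 0 ≤ y.symm 0 := by
  obtain ⟨p, q, hpq, hx, rfl⟩ := h
  have : (x * Equiv.swap p q).symm 0 = Equiv.swap p q (x.symm 0) := by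
    rw [Equiv.symm_apply_eq]
    simp
  rw [this, Equiv.swap_apply_def]
  split_ifs with h1 h2
  · omega
  · rw [← h2] at hx
    simp at hx
  · exact le_rfl

theorem symm_zero_le_of_reflTransGen {x y : Equiv.Perm ℕ} (h : ReflTransGen BruhatUp x y) :
    x.symm 0 ≤ y.symm 0 := by
  induction h with
  | refl => exact le_rfl
  | tail _ h ih => exact ih.trans h.symm_zero_le

theorem bruhatUp_of_ins {i : ℕ} {w w' : Equiv.Perm ℕ} (h : BruhatUp (ins i w) (ins i w')) :
    BruhatUp w w' := by
  obtain ⟨p, q, hpq, hw, he⟩ := h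
  have hq : q ≠ i := by
    rintro rfl
    rw [ins_apply_self] at hw
    omega
  have hp : p ≠ i := by
    rintro rfl
    have : ins p w' q = 0 := by
      rw [he, Equiv.Perm.mul_apply, Equiv.swap_apply_right, ins_apply_self]
    exact hq (by rw [← ins_symm_zero p w', ← this, Equiv.symm_apply_apply])
  obtain ⟨p, rfl⟩ := exists_skip_eq hp
  obtain ⟨q, rfl⟩ := exists_skip_eq hq
  rw [ins_mul_swap, ins_inj] at he
  refine ⟨p, q, (skip_strictMono i).lt_iff_lt.1 hpq, ?_, he.2⟩
  simpa only [ins_apply_skip, add_lt_add_iff_right] using hw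

theorem eq_of_bruhatUp_ins_succ {i : ℕ} {w w' : Equiv.Perm ℕ}
    (h : BruhatUp (ins i w) (ins (i + 1) w')) : w = w' := by
  obtain ⟨p, q, hpq, -, he⟩ := h
  have h0 : ins (i + 1) w' (i + 1) = 0 := ins_apply_self _ _
  rw [he, Equiv.Perm.mul_apply, ← ins_apply_self i w, EmbeddingLike.apply_eq_iff_eq,
    Equiv.swap_apply_def] at h0
  obtain ⟨rfl, rfl⟩ : p = i ∧ q = i + 1 := by
    split_ifs at h0 <;> omega
  rw [ins_mul_swap_succ, ins_inj] at he
  exact he.2.symm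

theorem reflTransGen_of_ins {j k : ℕ} {w' : Equiv.Perm ℕ} (hk : k ≤ j + 1) {i : ℕ}
    {w : Equiv.Perm ℕ} (hi : j ≤ i) (h : ReflTransGen BruhatUp (ins i w) (ins k w')) :
    ReflTransGen BruhatUp w w' := by
  generalize hx : ins i w = x at h
  induction h using ReflTransGen.head_induction_on generalizing i w with
  | refl => rw [(ins_inj.1 hx).2]
  | head hxy hy ih =>
    rename_i x y
    obtain ⟨i', v, rfl⟩ := exists_eq_ins y
    subst hx
    have h1 := hxy.symm_zero_le
    have h2 := symm_zero_le_of_reflTransGen hy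
    simp only [ins_symm_zero] at h1 h2
    have hv := ih (hi.trans h1) rfl
    obtain rfl | rfl : i' = i ∨ i' = i + 1 := by omega
    · exact .head (bruhatUp_of_ins hxy) hv
    · rwa [eq_of_bruhatUp_ins_succ hxy]

theorem exists_inSn_mul_swap {w : Equiv.Perm ℕ} (h : ∃ n, inSn n w) (p q : ℕ) :
    ∃ n, inSn n (w * Equiv.swap p q) := by
  obtain ⟨n, h⟩ := h
  refine ⟨n + p + q + 1, fun j hj => ?_⟩
  rw [Equiv.Perm.mul_apply, Equiv.swap_apply_of_ne_of_ne (by omega) (by omega)]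
  exact h j (by omega)

theorem exists_inSn_ins {w : Equiv.Perm ℕ} (h : ∃ n, inSn n w) (i : ℕ) :
    ∃ n, inSn n (ins i w) := by
  obtain ⟨n, h⟩ := h
  refine ⟨n + i + 1, fun j hj => ?_⟩
  have hj' : skip i (j - 1) = j := by
    unfold skip
    split_ifs <;> omega
  rw [← hj', ins_apply_skip, h _ (by omega), hj']
  omega

theorem finite_inversions {w : Equiv.Perm ℕ} (h : ∃ n, inSn n w) :
    {p : ℕ × ℕ | p.1 < p.2 ∧ w p.2 < w p.1}.Finite := by
  obtain ⟨n, h⟩ := h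
  refine ((Set.finite_Iio n).prod (Set.finite_Iio n)).subset ?_
  rintro ⟨x, y⟩ ⟨hxy, hw⟩
  simp only at hxy hw
  suffices y < n from ⟨hxy.trans this, this⟩
  by_contra! hy
  rw [h y hy] at hw
  have := w.injective (h (w x) (by omega))
  omega

theorem invCount_lt_mul_swap {w : Equiv.Perm ℕ} (hf : ∃ n, inSn n w) {p q : ℕ} (hpq : p < q)
    (hw : w p < w q) : invCount w < invCount (w * Equiv.swap p q) := by
  have hfin := finite_inversions (exists_inSn_mul_swap hf p q)
  set τ := Equiv.swap p q with hτ
  have hττ (x : ℕ) : τ (τ x) = x := Equiv.swap_apply_self p q x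
  have hpair : (p, q) ∈ {z : ℕ × ℕ | z.1 < z.2 ∧ (w * τ) z.2 < (w * τ) z.1} := by
    simpa [hτ] using ⟨hpq, hw⟩
  refine lt_of_le_of_lt ?_ (Set.ncard_sdiff_singleton_lt_of_mem hpair hfin)
  refine Set.ncard_le_ncard_of_injOn
    (fun z => if τ z.1 < τ z.2 then (τ z.1, τ z.2) else z) ?_ ?_ hfin.sdiff
  · rintro ⟨x, y⟩ ⟨hxy, hwxy⟩
    simp only at hxy hwxy
    simp only [Set.mem_sdiff, Set.mem_ofPred_eq, Set.mem_singleton_iff, Equiv.Perm.mul_apply]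
    split_ifs with h
    · refine ⟨⟨h, by simpa only [hττ]⟩, fun he => ?_⟩
      obtain ⟨hx, hy⟩ := Prod.mk.inj he
      have hx : x = q := by rw [← hττ x, hx, hτ, Equiv.swap_apply_left]
      have hy : y = p := by rw [← hττ y, hy, hτ, Equiv.swap_apply_right]
      omega
    · refine ⟨⟨hxy, ?_⟩, ?_⟩
      · simp only [hτ, Equiv.swap_apply_def] at h ⊢
        split_ifs at h ⊢ <;> subst_vars <;> omega
      · rintro he
        obtain ⟨rfl, rfl⟩ := Prod.ext_iff.1 he
        simp only at hwxy hw
        omega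
  · rintro ⟨x, y⟩ ⟨hxy, -⟩ ⟨x', y'⟩ ⟨hxy', -⟩ he
    simp only at hxy hxy' he
    split_ifs at he with h h' h' <;> simp only [Prod.mk.injEq] at he ⊢
    · simpa using he
    · rw [← he.1, ← he.2, hττ, hττ] at h'
      exact absurd hxy h'
    · rw [he.1, he.2, hττ, hττ] at h
      exact absurd hxy' h
    · exact he

theorem bruhatUp_iff {w w' : Equiv.Perm ℕ} (hf : ∃ n, inSn n w) :
    BruhatUp w w' ↔
      (∃ a b : ℕ, a ≠ b ∧ w' = w * Equiv.swap a b) ∧ invCount w < invCount w' := by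
  constructor
  · rintro ⟨p, q, hpq, hw, rfl⟩
    exact ⟨⟨p, q, hpq.ne, rfl⟩, invCount_lt_mul_swap hf hpq hw⟩
  · rintro ⟨⟨a, b, hab, rfl⟩, hlt⟩
    wlog h : a < b generalizing a b
    · rw [Equiv.swap_comm] at hlt ⊢
      exact this b a hab.symm hlt (by omega)
    refine ⟨a, b, h, ?_, rfl⟩
    by_contra! hw
    have hw : w b < w a := hw.lt_of_ne fun he => hab (w.injective he).symm
    have := invCount_lt_mul_swap (exists_inSn_mul_swap hf a b) h (by simpa using hw)
    rw [mul_assoc, Equiv.swap_mul_self, mul_one] at this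
    omega

theorem exists_inSn_of_reflTransGen {w w' : Equiv.Perm ℕ} (h : ReflTransGen BruhatUp w w')
    (hf : ∃ n, inSn n w) : ∃ n, inSn n w' := by
  induction h with
  | refl => exact hf
  | tail _ h ih =>
    obtain ⟨p, q, -, -, rfl⟩ := h
    exact exists_inSn_mul_swap ih p q

theorem bruhatLE_iff_reflTransGen {w w' : Equiv.Perm ℕ} (hf : ∃ n, inSn n w) :
    bruhatLE w w' ↔ ReflTransGen BruhatUp w w' := by
  constructor
  · rintro ⟨m, c, rfl, rfl, hc⟩
    induction m with
    | zero => exact .refl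
    | succ m ih =>
      have h := ih fun s hs => hc s (by omega)
      exact h.tail ((bruhatUp_iff (exists_inSn_of_reflTransGen h hf)).2 (hc m (by omega)))
  · intro h
    induction h with
    | refl => exact ⟨0, fun _ => w, rfl, rfl, by simp⟩
    | @tail x y hx hxy ih =>
      obtain ⟨m, c, h0, hm, hc⟩ := ih
      refine ⟨m + 1, fun s => if s ≤ m then c s else y, by simpa, by simp, fun s hs => ?_⟩
      obtain hs | rfl := Nat.lt_succ_iff_lt_or_eq.1 hs
      · have h1 : s ≤ m := by omega
        have h2 : s + 1 ≤ m := by omega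
        simpa only [h1, h2, if_true] using hc s hs
      · simpa [hm] using (bruhatUp_iff (exists_inSn_of_reflTransGen hx hf)).1 hxy

theorem uv_append_singleton (L : List RTLetter) (X : RTLetter) :
    uv (L ++ [X]) = stepRT (uv L) X := by
  simp [uv]

theorem exists_inSn_uv_fst (L : List RTLetter) : ∃ n, inSn n (uv L).1 := by
  induction L using List.reverseRecOn with
  | nil => exact ⟨0, fun _ _ => rfl⟩
  | append_singleton L X ih =>
    rw [uv_append_singleton]
    cases X <;> exact exists_inSn_ins ih _

theorem isReplacement_nil {M : List RTLetter} : isReplacement [] M ↔ M = [] := by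
  simp [isReplacement]

theorem isReplacement_append_singleton {L M : List RTLetter} {X : RTLetter} :
    isReplacement (L ++ [X]) M ↔ ∃ L' X', M = L' ++ [X'] ∧ isReplacement L L' ∧
      (X' = X ∨ ∃ k, X = .t k ∧ (X' = .r k ∨ X' = .r (k + 1))) := by
  rcases M.eq_nil_or_concat with rfl | ⟨L', X', rfl⟩
  · simp [isReplacement]
  simp only [List.concat_eq_append]
  have hlast (N : List RTLetter) (Y : RTLetter) : (N ++ [Y]).getD N.length (.r 0) = Y := by
    simp
  constructor
  · rintro ⟨hlen, h⟩
    have hlen : L'.length = L.length := by simpa using hlen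
    refine ⟨L', X', rfl, ⟨hlen, fun p hp => ?_⟩, ?_⟩
    · have := h p (by simp; omega)
      rwa [List.getD_append _ _ _ _ hp, List.getD_append _ _ _ _ (by omega)] at this
    · have := h L.length (by simp)
      rwa [hlast, ← hlen, hlast] at this
  · rintro ⟨_, _, he, ⟨hlen, h⟩, hX⟩
    obtain ⟨rfl, hXX⟩ := List.append_inj' he rfl
    obtain rfl := List.singleton_inj.1 hXX
    refine ⟨by simp [hlen], fun p hp => ?_⟩
    obtain hp | rfl : p < L.length ∨ p = L.length := by simp at hp; omega
    · rw [List.getD_append _ _ _ _ hp, List.getD_append _ _ _ _ (by omega)]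
      exact h p hp
    · rwa [hlast, ← hlen, hlast]

theorem reflTransGen_ins {w w' : Equiv.Perm ℕ} (i : ℕ) (h : ReflTransGen BruhatUp w w') :
    ReflTransGen BruhatUp (ins i w) (ins i w') :=
  h.lift (ins i) fun _ _ => bruhatUp_ins i

theorem reflTransGen_ins_succ {w w' : Equiv.Perm ℕ} (i : ℕ) (h : ReflTransGen BruhatUp w w') :
    ReflTransGen BruhatUp (ins i w) (ins (i + 1) w') :=
  (reflTransGen_ins i h).tail (bruhatUp_ins_succ i w')

theorem eq_one_of_reflTransGen_one {w : Equiv.Perm ℕ} (h : ReflTransGen BruhatUp w 1) :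
    w = 1 := by
  rcases h.cases_tail with h | ⟨x, -, p, q, hpq, hx, he⟩
  · exact h.symm
  · have hx' : x = Equiv.swap p q := by
      rw [← Equiv.swap_inv, ← mul_eq_one_iff_eq_inv, he]
    rw [hx', Equiv.swap_apply_left, Equiv.swap_apply_right] at hx
    omega

theorem reflTransGen_uv_iff (L : List RTLetter) (a b : Equiv.Perm ℕ) :
    (ReflTransGen BruhatUp (uv L).1 a ∧ ReflTransGen BruhatUp a b ∧
      ReflTransGen BruhatUp b (uv L).2) ↔
      ∃ L', isReplacement L L' ∧ a = (uv L').1 ∧ b = (uv L').2 := by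
  induction L using List.reverseRecOn generalizing a b with
  | nil =>
    simp only [isReplacement_nil, exists_eq_left]
    constructor
    · rintro ⟨-, hab, hb⟩
      obtain rfl := eq_one_of_reflTransGen_one hb
      exact ⟨eq_one_of_reflTransGen_one hab, rfl⟩
    · rintro ⟨rfl, rfl⟩
      exact ⟨.refl, .refl, .refl⟩
  | append_singleton L X ih =>
    simp only [isReplacement_append_singleton]
    constructor
    · rintro ⟨hu, hab, hv⟩
      obtain ⟨i, a, rfl⟩ := exists_eq_ins a
      obtain ⟨k, b, rfl⟩ := exists_eq_ins b
      have h1 := symm_zero_le_of_reflTransGen hu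
      have h2 := symm_zero_le_of_reflTransGen hab
      have h3 := symm_zero_le_of_reflTransGen hv
      rw [uv_append_singleton] at hu hv h1 h3
      obtain ⟨X', hX', hstep⟩ : ∃ X',
          (X' = X ∨ ∃ k, X = .t k ∧ (X' = .r k ∨ X' = .r (k + 1))) ∧
            stepRT (a, b) X' = (ins i a, ins k b) := by
        cases X with
        | r j =>
          simp only [stepRT, ins_symm_zero] at h1 h2 h3
          obtain rfl : i = j := by omega
          obtain rfl : k = i := by omega
          exact ⟨_, .inl rfl, rfl⟩
        | t j =>
          simp only [stepRT, ins_symm_zero] at h1 h2 h3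
          obtain ⟨rfl, rfl⟩ | ⟨rfl, rfl⟩ | ⟨rfl, rfl⟩ :
            (i = j ∧ k = j) ∨ (i = j ∧ k = j + 1) ∨ (i = j + 1 ∧ k = j + 1) := by omega
          · exact ⟨.r k, .inr ⟨k, rfl, .inl rfl⟩, rfl⟩
          · exact ⟨_, .inl rfl, rfl⟩
          · exact ⟨.r (j + 1), .inr ⟨j, rfl, .inr rfl⟩, rfl⟩
      have key : ReflTransGen BruhatUp (uv L).1 a ∧ ReflTransGen BruhatUp a b ∧
          ReflTransGen BruhatUp b (uv L).2 := by
        cases X <;> simp only [stepRT, ins_symm_zero] at h1 h2 h3 hu hv <;>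
          exact ⟨reflTransGen_of_ins (by omega) le_rfl hu,
            reflTransGen_of_ins (by omega) h1 hab,
            reflTransGen_of_ins (by omega) (h1.trans h2) hv⟩
      obtain ⟨L', hL', rfl, rfl⟩ := (ih a b).1 key
      refine ⟨_, ⟨L', X', rfl, hL', hX'⟩, ?_⟩
      rw [uv_append_singleton, hstep]
      exact ⟨rfl, rfl⟩
    · rintro ⟨_, ⟨L', X', rfl, hL', hX'⟩, rfl, rfl⟩
      obtain ⟨hu, huv, hv⟩ := (ih _ _).2 ⟨L', hL', rfl, rfl⟩
      simp only [uv_append_singleton]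
      obtain rfl | ⟨k, rfl, rfl | rfl⟩ := hX'
      · cases X' with
        | r j => exact ⟨reflTransGen_ins j hu, reflTransGen_ins j huv, reflTransGen_ins j hv⟩
        | t j =>
          exact ⟨reflTransGen_ins j hu, reflTransGen_ins_succ j huv,
            reflTransGen_ins (j + 1) hv⟩
      · exact ⟨reflTransGen_ins k hu, reflTransGen_ins k huv, reflTransGen_ins_succ k hv⟩
      · exact ⟨reflTransGen_ins_succ k hu, reflTransGen_ins (k + 1) huv,
          reflTransGen_ins (k + 1) hv⟩

theorem stmt15 (n : ℕ) (L : List RTLetter) (hL : validSeq n L) (a b : Equiv.Perm ℕ) :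
    (bruhatLE (uv L).1 a ∧ bruhatLE a b ∧ bruhatLE b (uv L).2) ↔
      ∃ L', isReplacement L L' ∧ a = (uv L').1 ∧ b = (uv L').2 := by
  rw [← reflTransGen_uv_iff, bruhatLE_iff_reflTransGen (exists_inSn_uv_fst L)]
  refine and_congr_right fun hu => ?_
  have ha := exists_inSn_of_reflTransGen hu (exists_inSn_uv_fst L)
  rw [bruhatLE_iff_reflTransGen ha]
  refine and_congr_right fun hab => ?_
  rw [bruhatLE_iff_reflTransGen (exists_inSn_of_reflTransGen hab ha)]
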